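/- arXiv:1011.3183 — 3 statements merged into one kernel-verified Lean document; each statement's English description precedes it below -/
import Mathlib

section
/- For Lebesgue-almost every y ∈ [0, 2/3], the level set L(y) = {x ∈ [0,1] : τ(x) = y} of the Takagi function is a finite set. -/
open MeasureTheory Set

/-- Distance from a real number to the nearest integer. -/
noncomputable def distNearestInt (t : ℝ) : ℝ := |t - round t|

/-- The Takagi function. -/
noncomputable def takagi (x : ℝ) : ℝ := ∑' n : ℕ, distNearestInt (2 ^ n * x) / 2 ^ n

/-- The `j`-th binary digit of `x ∈ [0,1)` (binary expansion terminating in `0^∞`). -/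
noncomputable def bdigit (x : ℝ) (j : ℕ) : ℤ := ⌊(2 : ℝ) ^ j * x⌋ - 2 * ⌊(2 : ℝ) ^ (j - 1) * x⌋

/-- The deficient digit function `D_j(x) = j - 2(b_1(x) + ⋯ + b_j(x))`. -/
noncomputable def defDigit (x : ℝ) (j : ℕ) : ℤ := (j : ℤ) - 2 * ∑ i ∈ Finset.Icc 1 j, bdigit x i

/-- The deficient digit set `Ω^L`. -/
noncomputable def OmegaL : Set ℝ := {x | x ∈ Set.Ico (0 : ℝ) 1 ∧ ∀ j : ℕ, 1 ≤ j → 0 ≤ defDigit x j}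

/-- The set `½Ω^L = {x ∈ [0,1) : D_j(x) > 0 for all j ≥ 1}`. -/
noncomputable def halfOmegaL : Set ℝ :=
  {x | x ∈ Set.Ico (0 : ℝ) 1 ∧ ∀ j : ℕ, 1 ≤ j → 0 < defDigit x j}

/-- The Takagi singular function. -/
noncomputable def takagiS (x : ℝ) : ℝ := sSup {y | ∃ t ∈ OmegaL, t ≤ x ∧ y = takagi t + t}

/-- `Ω^L_∞`: points of `Ω^L` with infinitely many balance points. -/
noncomputable def OmegaLinf : Set ℝ :=
  {x ∈ OmegaL | {j : ℕ | 1 ≤ j ∧ defDigit x j = 0}.Infinite}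

/-- `Ω^L_fin = Ω^L \ Ω^L_∞`. -/
noncomputable def OmegaLfin : Set ℝ := OmegaL \ OmegaLinf

/-- `(m, k)` encodes a member `k / 2^(2m)` of the breakpoint set `ℬ'`. -/
noncomputable def breakpoint (m k : ℕ) : Prop :=
  (m = 0 ∧ k = 0) ∨
    (1 ≤ m ∧ 0 < k ∧ k < 2 ^ (2 * m) ∧
      (∀ j : ℕ, 1 ≤ j → j ≤ 2 * m - 1 → 0 ≤ defDigit ((k : ℝ) / 2 ^ (2 * m)) j) ∧
      defDigit ((k : ℝ) / 2 ^ (2 * m)) (2 * m) = 0)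

/-- The fine partition set `Ω^L(B)` for `B = k / 2^(2m)`. -/
noncomputable def fineSet (m k : ℕ) : Set ℝ :=
  {x | ∃ x' ∈ halfOmegaL, x = (k : ℝ) / 2 ^ (2 * m) + x' / 2 ^ (2 * m)}

/-- The set `Γ_{2r}`. -/
noncomputable def Gamma (r : ℕ) : Set ℝ :=
  {x | x ∈ Set.Ico (0 : ℝ) 1 ∧ ∀ j : ℕ, 1 ≤ j →
    ((¬ (2 * r ∣ j) → 0 < defDigit x j) ∧ ((2 * r) ∣ j → defDigit x j = 0))}

/-- The level set `L(y)` of the Takagi function. -/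
noncomputable def levelSet (y : ℝ) : Set ℝ := {x ∈ Set.Icc (0 : ℝ) 1 | takagi x = y}

lemma dni_nonneg (t : ℝ) : 0 ≤ distNearestInt t := abs_nonneg _

lemma dni_le (t : ℝ) : distNearestInt t ≤ 1 / 2 := abs_sub_round t

lemma dni_add_int (t : ℝ) (k : ℤ) : distNearestInt (t + k) = distNearestInt t := by
  unfold distNearestInt
  rw [round_add_intCast]
  push_cast
  congr 1
  ring

lemma dni_neg (t : ℝ) : distNearestInt (-t) = distNearestInt t := by
  unfold distNearestInt
  apply le_antisymm
  · have := round_le (-t) (-round t)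
    refine this.trans_eq ?_
    push_cast
    rw [← abs_neg]; congr 1; ring
  · have := round_le t (-round (-t))
    refine this.trans_eq ?_
    push_cast
    rw [← abs_neg]; congr 1; ring

lemma dni_left {t : ℝ} (h0 : 0 ≤ t) (h1 : t ≤ 1 / 2) : distNearestInt t = t := by
  unfold distNearestInt
  have hf : Int.fract t = t := Int.fract_eq_self.2 ⟨h0, by linarith⟩
  rw [abs_sub_round_eq_min, hf]
  exact min_eq_left (by linarith)

lemma dni_right {t : ℝ} (h0 : 1 / 2 ≤ t) (h1 : t ≤ 1) : distNearestInt t = 1 - t := by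
  have h := dni_add_int (-t) 1
  rw [dni_neg] at h
  rw [← h, dni_left] <;> push_cast <;> linarith

lemma tk_summable (x : ℝ) : Summable (fun n : ℕ => distNearestInt (2 ^ n * x) / 2 ^ n) := by
  refine Summable.of_nonneg_of_le (fun n => div_nonneg (dni_nonneg _) (by positivity)) (fun n => ?_)
    (summable_geometric_two' 1)
  exact (div_le_div_of_nonneg_right (dni_le _) (by positivity))

lemma tk_nonneg (x : ℝ) : 0 ≤ takagi x :=
  tsum_nonneg (fun n => div_nonneg (dni_nonneg _) (by positivity))

lemma tk_le (x : ℝ) : takagi x ≤ 1 := by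
  unfold takagi
  rw [← tsum_geometric_two' 1]
  exact (tk_summable x).tsum_le_tsum
    (fun n => (div_le_div_of_nonneg_right (dni_le _) (by positivity))) (summable_geometric_two' 1)

lemma tk_add_int (x : ℝ) (k : ℤ) : takagi (x + k) = takagi x := by
  unfold takagi
  congr 1; ext n
  have := dni_add_int (2 ^ n * x) (2 ^ n * k)
  push_cast at this
  rw [mul_add, this]

lemma tk_neg (x : ℝ) : takagi (-x) = takagi x := by
  unfold takagi
  congr 1; ext n
  rw [mul_neg, dni_neg]

lemma tk_symm (x : ℝ) : takagi (1 - x) = takagi x := by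
  have := tk_add_int (-x) 1
  rw [tk_neg] at this
  rw [← this]; push_cast; congr 1; ring

lemma tk_fe (x : ℝ) : takagi x = distNearestInt x + takagi (2 * x) / 2 := by
  have h := (tk_summable x).tsum_eq_zero_add
  unfold takagi
  rw [h, ← tsum_div_const]
  simp only [pow_zero, one_mul, div_one, add_right_inj]
  congr 1; ext n
  rw [pow_succ]
  rw [div_div, mul_assoc]

lemma tk_zero : takagi 0 = 0 := by
  have h := tk_fe 0
  rw [dni_left le_rfl (by norm_num), mul_zero] at h
  linarith

lemma tk_int (k : ℤ) : takagi k = 0 := by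
  have := tk_add_int 0 k
  rwa [zero_add, tk_zero] at this

lemma tk_half {t : ℝ} (h0 : 0 ≤ t) (h1 : t ≤ 1) : takagi (t / 2) = t / 2 + takagi t / 2 := by
  rw [tk_fe, dni_left (by linarith) (by linarith)]
  congr 3; ring

lemma tk_half' {t : ℝ} (h0 : 0 ≤ t) (h1 : t ≤ 1) :
    takagi ((1 + t) / 2) = (1 - t) / 2 + takagi t / 2 := by
  rw [tk_fe, dni_right (by linarith) (by linarith)]
  have : 2 * ((1 + t) / 2) = t + ((1 : ℤ) : ℝ) := by push_cast; ring
  rw [this, tk_add_int]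
  ring

/-- slope -/
def dsl : ℕ → ℤ → ℤ
  | 0, _ => 0
  | n + 1, k => dsl n (k / 2) + (if k % 2 = 0 then 1 else -1)

lemma tk_affine (n : ℕ) : ∀ (k : ℤ) {t : ℝ}, 0 ≤ t → t ≤ 1 →
    takagi ((k + t) / 2 ^ n) = takagi (k / 2 ^ n) + (takagi t + dsl n k * t) / 2 ^ n := by
  induction n with
  | zero =>
    intro k t h0 h1
    simp only [pow_zero, div_one, dsl, tk_int]
    rw [add_comm, tk_add_int]; simp
  | succ n ih =>
    intro k t h0 h1
    have hk := Int.emod_add_mul_ediv k 2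
    set q := k / 2 with hq
    rcases Int.emod_two_eq_zero_or_one k with h | h
    · rw [h] at hk
      have hk' : (k : ℝ) = 2 * q := by rw [← hk]; push_cast; ring
      have e1 : ((k : ℝ) + t) / 2 ^ (n + 1) = (q + t / 2) / 2 ^ n := by
        rw [hk', pow_succ]; field_simp
      have e2 : ((k : ℝ)) / 2 ^ (n + 1) = q / 2 ^ n := by
        rw [hk', pow_succ]; field_simp
      rw [e1, e2, ih q (by linarith) (by linarith), tk_half h0 h1]
      simp only [dsl, h, ← hq, if_true]
      push_cast
      rw [pow_succ]; field_simp; ring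
    · rw [h] at hk
      have hk' : (k : ℝ) = 2 * q + 1 := by rw [← hk]; push_cast; ring
      have e1 : ((k : ℝ) + t) / 2 ^ (n + 1) = (q + (1 + t) / 2) / 2 ^ n := by
        rw [hk', pow_succ]; field_simp; ring
      have e2 : ((k : ℝ)) / 2 ^ (n + 1) = (q + (1 + 0) / 2) / 2 ^ n := by
        rw [hk', pow_succ]; field_simp; ring
      rw [e1, e2, ih q (by linarith) (by linarith), ih q (by norm_num) (by norm_num),
        tk_half' h0 h1, tk_half' le_rfl zero_le_one, tk_zero]
      simp only [dsl, h, ← hq]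
      push_cast
      rw [pow_succ]; field_simp; simp; ring

lemma floor_shift (x : ℝ) (j i : ℕ) : ⌊(2 : ℝ) ^ (j + i) * x⌋ / 2 ^ i = ⌊(2 : ℝ) ^ j * x⌋ := by
  have := Int.floor_div_natCast ((2 : ℝ) ^ (j + i) * x) (2 ^ i)
  push_cast at this
  rw [← this]
  congr 1
  rw [pow_add]; field_simp

lemma floor_succ_div (x : ℝ) (j : ℕ) : ⌊(2 : ℝ) ^ (j + 1) * x⌋ / 2 = ⌊(2 : ℝ) ^ j * x⌋ := by
  simpa using floor_shift x j 1

/-- slope at `x` -/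
noncomputable def dx (x : ℝ) (n : ℕ) : ℤ := dsl n ⌊(2 : ℝ) ^ n * x⌋

lemma dx_zero (x : ℝ) : dx x 0 = 0 := rfl

lemma dx_succ (x : ℝ) (n : ℕ) :
    dx x (n + 1) = dx x n + (if ⌊(2 : ℝ) ^ (n + 1) * x⌋ % 2 = 0 then 1 else -1) := by
  simp only [dx, dsl, floor_succ_div]

lemma dx_succ_ge (x : ℝ) (n : ℕ) : dx x n - 1 ≤ dx x (n + 1) := by
  rw [dx_succ]; split_ifs <;> omega

/-- positive walk points -/
def HH : Set ℝ := {x | x ∈ Set.Ico (0 : ℝ) 1 ∧ ∀ j : ℕ, 1 ≤ j → 0 < dx x j}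

lemma tk_at (x : ℝ) (n : ℕ) : takagi x = takagi (⌊(2 : ℝ) ^ n * x⌋ / 2 ^ n) +
    (takagi (Int.fract ((2 : ℝ) ^ n * x)) + dx x n * Int.fract ((2 : ℝ) ^ n * x)) / 2 ^ n := by
  have h := tk_affine n ⌊(2 : ℝ) ^ n * x⌋ (Int.fract_nonneg ((2 : ℝ) ^ n * x))
    (Int.fract_lt_one _).le
  rw [Int.floor_add_fract, mul_div_cancel_left₀ x (by positivity)] at h
  exact h

lemma tk_right (x : ℝ) (n : ℕ) : takagi ((⌊(2 : ℝ) ^ n * x⌋ + 1) / 2 ^ n) =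
    takagi (⌊(2 : ℝ) ^ n * x⌋ / 2 ^ n) + dx x n / 2 ^ n := by
  have h := tk_affine n ⌊(2 : ℝ) ^ n * x⌋ zero_le_one le_rfl
  rw [h]
  have : takagi 1 = 0 := by simpa using tk_int 1
  simp [this, dx]

lemma HH_left {x : ℝ} (hx : x ∈ HH) {n : ℕ} (hn : 1 ≤ n) :
    takagi (⌊(2 : ℝ) ^ n * x⌋ / 2 ^ n) ≤ takagi x := by
  rw [tk_at x n]
  have h1 : (0 : ℝ) < dx x n := by exact_mod_cast hx.2 n hn
  have := tk_nonneg (Int.fract ((2 : ℝ) ^ n * x))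
  have := Int.fract_nonneg ((2 : ℝ) ^ n * x)
  have : 0 ≤ (takagi (Int.fract ((2 : ℝ) ^ n * x)) + dx x n * Int.fract ((2 : ℝ) ^ n * x)) / 2 ^ n := by
    positivity
  linarith

lemma HH_right_approx {x : ℝ} (hx : x ∈ HH) {n : ℕ} (hn : 1 ≤ n) :
    takagi x ≤ takagi ((⌊(2 : ℝ) ^ n * x⌋ + 1) / 2 ^ n) + (1 / 2) ^ n := by
  rw [tk_at x n, tk_right]
  have h1 : (0 : ℝ) < dx x n := by exact_mod_cast hx.2 n hn
  have h2 := tk_le (Int.fract ((2 : ℝ) ^ n * x))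
  have h3 := (Int.fract_lt_one ((2 : ℝ) ^ n * x)).le
  rw [add_assoc, one_div, inv_pow, ← one_div, ← add_div]
  refine add_le_add le_rfl (div_le_div_of_nonneg_right ?_ (by positivity))
  nlinarith

lemma HH_right_step {x : ℝ} (hx : x ∈ HH) {n : ℕ} (hn : 1 ≤ n) :
    takagi ((⌊(2 : ℝ) ^ (n + 1) * x⌋ + 1) / 2 ^ (n + 1)) ≤
    takagi ((⌊(2 : ℝ) ^ n * x⌋ + 1) / 2 ^ n) := by
  have h1 : (1 : ℝ) ≤ dx x n := by exact_mod_cast hx.2 n hn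
  have hk := Int.emod_add_mul_ediv ⌊(2 : ℝ) ^ (n + 1) * x⌋ 2
  rw [floor_succ_div] at hk
  rcases Int.emod_two_eq_zero_or_one ⌊(2 : ℝ) ^ (n + 1) * x⌋ with h | h
  · rw [h] at hk
    rw [← hk, tk_right]
    have e : (((0 + 2 * ⌊(2 : ℝ) ^ n * x⌋ : ℤ) : ℝ) + 1) / 2 ^ (n + 1) =
        (⌊(2 : ℝ) ^ n * x⌋ + (1 + 0) / 2) / 2 ^ n := by
      push_cast; rw [pow_succ]; field_simp; ring
    rw [e, tk_affine n _ (by norm_num) (by norm_num), tk_half' le_rfl zero_le_one, tk_zero]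
    gcongr
    change _ + (dx x n : ℝ) * _ ≤ _
    linarith
  · rw [h] at hk
    rw [← hk]
    apply le_of_eq
    congr 1
    push_cast; rw [pow_succ]; field_simp; ring

lemma HH_right {x : ℝ} (hx : x ∈ HH) {n : ℕ} (hn : 1 ≤ n) :
    takagi x ≤ takagi ((⌊(2 : ℝ) ^ n * x⌋ + 1) / 2 ^ n) := by
  have hm : ∀ i : ℕ, takagi ((⌊(2 : ℝ) ^ (n + i) * x⌋ + 1) / 2 ^ (n + i)) ≤
      takagi ((⌊(2 : ℝ) ^ n * x⌋ + 1) / 2 ^ n) := by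
    intro i
    induction i with
    | zero => exact le_rfl
    | succ i ih => exact (HH_right_step hx (by omega : 1 ≤ n + i)).trans ih
  apply le_of_forall_pos_le_add
  intro ε hε
  obtain ⟨i, hi⟩ := exists_pow_lt_of_lt_one hε (by norm_num : (1 / 2 : ℝ) < 1)
  have h1 := HH_right_approx hx (by omega : 1 ≤ n + i)
  have h2 : ((1 : ℝ) / 2) ^ (n + i) ≤ (1 / 2) ^ i :=
    pow_le_pow_of_le_one (by norm_num) (by norm_num) (by omega)
  linarith [hm i]

lemma HH_mono : MonotoneOn takagi HH := by
  intro x hx z hz hxz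
  rcases hxz.eq_or_lt with h | hlt
  · rw [h]
  classical
  have hex : ∃ j : ℕ, ⌊(2 : ℝ) ^ j * x⌋ < ⌊(2 : ℝ) ^ j * z⌋ := by
    obtain ⟨j, hj⟩ := pow_unbounded_of_one_lt (1 / (z - x)) (by norm_num : (1 : ℝ) < 2)
    refine ⟨j, ?_⟩
    rw [div_lt_iff₀ (by linarith)] at hj
    have : ⌊(2 : ℝ) ^ j * x⌋ + 1 ≤ ⌊(2 : ℝ) ^ j * z⌋ := by
      rw [Int.le_floor]; push_cast
      have := Int.floor_le ((2 : ℝ) ^ j * x)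
      linarith
    omega
  obtain ⟨h1, h2⟩ := And.intro (Nat.find_spec hex) (fun m => Nat.find_min hex (m := m))
  set j := Nat.find hex
  have f0 : ∀ w ∈ Set.Ico (0 : ℝ) 1, ⌊(2 : ℝ) ^ 0 * w⌋ = 0 := by
    intro w hw
    rw [pow_zero, one_mul]; exact Int.floor_eq_zero_iff.2 hw
  rcases hj : j with _ | i
  · rw [hj, f0 x hx.1, f0 z hz.1] at h1; exact absurd h1 (lt_irrefl _)
  · have h3 := h2 i (by omega)
    rw [hj] at h1
    have a := floor_succ_div x i
    have b := floor_succ_div z i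
    have c : ⌊(2 : ℝ) ^ i * x⌋ ≤ ⌊(2 : ℝ) ^ i * z⌋ := by gcongr
    have e : ⌊(2 : ℝ) ^ (i + 1) * z⌋ = ⌊(2 : ℝ) ^ (i + 1) * x⌋ + 1 := by omega
    have r := HH_right hx (by omega : 1 ≤ i + 1)
    have l := HH_left hz (by omega : 1 ≤ i + 1)
    rw [e] at l; push_cast at l
    exact r.trans l

/-- first-return words -/
def VV : Set (ℕ × ℤ) := {v | 1 ≤ v.1 ∧ dsl v.1 v.2 = 0 ∧
  (∃ x ∈ Set.Ico (0 : ℝ) (1 / 2), ⌊(2 : ℝ) ^ v.1 * x⌋ = v.2) ∧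
  ∀ j i : ℕ, 1 ≤ j → 1 ≤ i → j + i = v.1 → 0 < dsl j (v.2 / 2 ^ i)}

/-- interval of a word -/
def JJ (v : ℕ × ℤ) : Set ℝ := Set.Ico ((v.2 : ℝ) / 2 ^ v.1) ((v.2 + 1) / 2 ^ v.1)

lemma mem_JJ {v : ℕ × ℤ} {x : ℝ} : x ∈ JJ v ↔ ⌊(2 : ℝ) ^ v.1 * x⌋ = v.2 := by
  rw [Int.floor_eq_iff, JJ, Set.mem_Ico, div_le_iff₀ (by positivity), lt_div_iff₀ (by positivity),
    mul_comm x]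

lemma JJ_disj {v w : ℕ × ℤ} (hv : v ∈ VV) (hw : w ∈ VV) {x : ℝ} (h1 : x ∈ JJ v) (h2 : x ∈ JJ w) :
    v.1 ≥ w.1 := by
  by_contra! h
  rw [mem_JJ] at h1 h2
  have := hw.2.2.2 v.1 (w.1 - v.1) hv.1 (by omega) (by omega)
  rw [← h2] at this
  have e := floor_shift x v.1 (w.1 - v.1)
  rw [show v.1 + (w.1 - v.1) = w.1 by omega] at e
  rw [e, h1, hv.2.1] at this
  exact lt_irrefl _ this

lemma JJ_sub {v : ℕ × ℤ} (hv : v ∈ VV) : JJ v ⊆ Set.Ico (0 : ℝ) (1 / 2) := by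
  intro z hz
  obtain ⟨hn, -, ⟨x, hx, hxv⟩, -⟩ := hv
  rw [mem_JJ] at hz
  have e : ⌊(2 : ℝ) ^ 1 * z⌋ = ⌊(2 : ℝ) ^ 1 * x⌋ := by
    have a := floor_shift z 1 (v.1 - 1)
    have b := floor_shift x 1 (v.1 - 1)
    rw [show 1 + (v.1 - 1) = v.1 by omega] at a b
    rw [← a, ← b, hz, hxv]
  have : ⌊(2 : ℝ) ^ 1 * x⌋ = 0 := by
    rw [Int.floor_eq_zero_iff]; constructor <;> linarith [hx.1, hx.2]
  rw [this, Int.floor_eq_zero_iff] at e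
  constructor <;> linarith [e.1, e.2]

lemma JJ_vol (v : ℕ × ℤ) : volume (JJ v) = ENNReal.ofReal (1 / 2 ^ v.1) := by
  rw [JJ, Real.volume_Ico]; congr 1; ring

lemma kraft : ∑' v : VV, ENNReal.ofReal (1 / 2 ^ v.1.1) ≤ ENNReal.ofReal (1 / 2) := by
  have : ∑' v : VV, volume (JJ v.1) = volume (⋃ v : VV, JJ v.1) := by
    rw [measure_iUnion]
    · intro v w hvw
      refine Set.disjoint_left.2 fun x h1 h2 => hvw ?_
      have a := JJ_disj v.2 w.2 h1 h2
      have b := JJ_disj w.2 v.2 h2 h1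
      have e : v.1.1 = w.1.1 := le_antisymm b a
      rw [mem_JJ] at h1 h2
      exact Subtype.ext (Prod.ext e (by rw [← h1, ← h2, e]))
    · intro v; exact measurableSet_Ico
  simp only [JJ_vol] at this
  rw [this]
  refine (measure_mono (Set.iUnion_subset fun v => JJ_sub v.2)).trans_eq ?_
  rw [Real.volume_Ico]; congr 1; norm_num

/-- rescaling of levels -/
noncomputable def SS (v : ℕ × ℤ) (y : ℝ) : ℝ := 2 ^ v.1 * (y - takagi (v.2 / 2 ^ v.1))

lemma SS_vol (v : ℕ × ℤ) (B : Set ℝ) :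
    volume (SS v ⁻¹' B) = ENNReal.ofReal (1 / 2 ^ v.1) * volume B := by
  have : SS v ⁻¹' B = (fun y => y + -takagi (v.2 / 2 ^ v.1)) ⁻¹' ((fun y => (2 : ℝ) ^ v.1 * y) ⁻¹' B) := by
    ext y; simp [SS, sub_eq_add_neg]
  rw [this, measure_preimage_add_right, Real.volume_preimage_mul_left (by positivity)]
  congr 2
  rw [abs_of_pos (by positivity), one_div]

lemma JJ_level {v : ℕ × ℤ} (hv : v ∈ VV) {x : ℝ} (hx : x ∈ JJ v) :
    (2 : ℝ) ^ v.1 * x - v.2 ∈ levelSet (SS v (takagi x)) := by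
  have h := tk_at x v.1
  rw [mem_JJ] at hx
  have hf : Int.fract ((2 : ℝ) ^ v.1 * x) = (2 : ℝ) ^ v.1 * x - v.2 := by
    rw [Int.fract, hx]
  have hd : dx x v.1 = 0 := by rw [dx, hx, hv.2.1]
  refine ⟨⟨?_, ?_⟩, ?_⟩
  · rw [← hf]; exact Int.fract_nonneg _
  · rw [← hf]; exact (Int.fract_lt_one _).le
  · rw [hd, hf, hx] at h
    rw [SS, h]; simp
    field_simp

lemma cover {x : ℝ} (hx : x ∈ Set.Ico (0 : ℝ) (1 / 2)) : x ∈ HH ∨ ∃ v : VV, x ∈ JJ v.1 := by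
  classical
  by_cases hex : ∃ j : ℕ, 1 ≤ j ∧ dx x j ≤ 0
  · right
    obtain ⟨⟨h0, h1⟩, h2⟩ := And.intro (Nat.find_spec hex) (fun m => Nat.find_min hex (m := m))
    set n := Nat.find hex
    have d1 : dx x 1 = 1 := by
      have : ⌊(2 : ℝ) ^ (0 + 1) * x⌋ = 0 := by
        rw [Int.floor_eq_zero_iff, zero_add, pow_one]; constructor <;> linarith [hx.1, hx.2]
      have h := dx_succ x 0
      rw [this, dx_zero] at h
      simpa using h
    have hpos : ∀ j, 1 ≤ j → j < n → 0 < dx x j := by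
      intro j hj hjn
      by_contra! hc
      exact h2 j hjn ⟨hj, hc⟩
    have hn2 : 2 ≤ n := by
      by_contra! hc
      have : n = 1 := by omega
      rw [this, d1] at h1; omega
    have hz : dx x n = 0 := by
      have a := dx_succ_ge x (n - 1)
      rw [show n - 1 + 1 = n by omega] at a
      have b := hpos (n - 1) (by omega) (by omega)
      omega
    refine ⟨⟨(n, ⌊(2 : ℝ) ^ n * x⌋), h0, hz, ⟨x, hx, rfl⟩, ?_⟩, mem_JJ.2 rfl⟩
    intro j i hj hi hji
    have hji' : j + i = n := hji
    have := hpos j hj (by omega)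
    rw [dx, ← floor_shift x j i, hji'] at this
    exact this
  · left
    push Not at hex
    exact ⟨⟨hx.1, by linarith [hx.2]⟩, hex⟩

/-- bad levels -/
def BB : Set ℝ := {y | ¬ (levelSet y).Finite}

lemma level_nonempty {y : ℝ} (h : (levelSet y).Nonempty) : y ∈ Set.Icc (0 : ℝ) 1 := by
  obtain ⟨x, -, rfl⟩ := h
  exact ⟨tk_nonneg x, tk_le x⟩

/-- Borel-Cantelli set -/
def FF : Set ℝ := {y | {v : VV | y ∈ SS v.1 ⁻¹' Set.Icc (0 : ℝ) 1}.Infinite}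

lemma FF_null : volume FF = 0 := by
  have := measure_limsup_cofinite_eq_zero (μ := volume)
    (s := fun v : VV => SS v.1 ⁻¹' Set.Icc (0 : ℝ) 1) (by
      simp only [SS_vol, Real.volume_Icc, sub_zero, ENNReal.ofReal_one, mul_one]
      exact ne_top_of_le_ne_top ENNReal.ofReal_ne_top kraft)
  rw [Filter.cofinite.limsup_set_eq] at this
  exact this

/-- double levels of `HH` -/
def CC : Set ℝ := {y | ∃ x ∈ HH, ∃ z ∈ HH, x < z ∧ takagi x = y ∧ takagi z = y}

lemma CC_countable : CC.Countable := by
  have := HH_mono.countable_setOfPred_two_preimages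
  refine this.mono ?_
  rintro y ⟨x, hx, z, hz, hlt, h1, h2⟩
  exact ⟨x, z, hx, hz, hlt, h1, h2⟩

lemma BB_sub : BB ⊆ CC ∪ FF ∪ ⋃ v : VV, SS v.1 ⁻¹' BB := by
  intro y hy
  by_contra hc
  simp only [Set.mem_union, Set.mem_iUnion, not_or, not_exists] at hc
  obtain ⟨⟨hC, hF⟩, hS⟩ := hc
  apply hy
  have hV : {v : VV | y ∈ SS v.1 ⁻¹' Set.Icc (0 : ℝ) 1}.Finite := Set.not_infinite.1 hF
  have hL : ∀ v : VV, (levelSet (SS v.1 y)).Finite := fun v => not_not.1 (hS v)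
  have h1 : (HH ∩ takagi ⁻¹' {y}).Finite := by
    apply Set.Subsingleton.finite
    intro x hx z hz
    by_contra hne
    rcases lt_or_gt_of_ne hne with h | h
    · exact hC ⟨x, hx.1, z, hz.1, h, hx.2, hz.2⟩
    · exact hC ⟨z, hz.1, x, hx.1, h, hz.2, hx.2⟩
  have h2 : (⋃ v ∈ {v : VV | y ∈ SS v.1 ⁻¹' Set.Icc (0 : ℝ) 1},
      (fun t : ℝ => (t + v.1.2) / 2 ^ v.1.1) '' levelSet (SS v.1 y)).Finite :=
    hV.biUnion fun v _ => (hL v).image _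
  have h3 : (Set.Ico (0 : ℝ) (1 / 2) ∩ takagi ⁻¹' {y}).Finite := by
    refine (h1.union h2).subset ?_
    rintro x ⟨hx, hxy⟩
    rcases cover hx with h | ⟨v, hv⟩
    · exact Or.inl ⟨h, hxy⟩
    · right
      have hm := JJ_level v.2 hv
      rw [show takagi x = y from hxy] at hm
      simp only [Set.mem_iUnion]
      refine ⟨v, level_nonempty ⟨_, hm⟩, _, hm, ?_⟩
      simp
  refine ((h3.union (h3.image (fun x => 1 - x))).union (Set.finite_singleton (1 / 2 : ℝ))).subset ?_
  rintro x ⟨hx, hxy⟩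
  rcases lt_trichotomy x (1 / 2) with h | h | h
  · exact Or.inl (Or.inl ⟨⟨hx.1, h⟩, hxy⟩)
  · exact Or.inr h
  · refine Or.inl (Or.inr ⟨1 - x, ⟨⟨by linarith [hx.2], by linarith⟩, ?_⟩, by simp⟩)
    change takagi (1 - x) = y
    rw [tk_symm, hxy]

lemma BB_null : volume BB = 0 := by
  have hfin : volume BB ≠ ⊤ := by
    refine ne_top_of_le_ne_top ?_ (measure_mono (t := Set.Icc (0 : ℝ) 1) ?_)
    · simp
    · intro y hy
      exact level_nonempty (Set.Infinite.nonempty hy)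
  have h : volume BB ≤ ENNReal.ofReal (1 / 2) * volume BB := by
    calc volume BB ≤ volume (CC ∪ FF ∪ ⋃ v : VV, SS v.1 ⁻¹' BB) := measure_mono BB_sub
      _ ≤ volume CC + volume FF + volume (⋃ v : VV, SS v.1 ⁻¹' BB) :=
        (measure_union_le _ _).trans (by gcongr; exact measure_union_le _ _)
      _ ≤ 0 + 0 + ∑' v : VV, volume (SS v.1 ⁻¹' BB) := by
        rw [CC_countable.measure_zero, FF_null]
        gcongr
        exact measure_iUnion_le _
      _ = (∑' v : VV, ENNReal.ofReal (1 / 2 ^ v.1.1)) * volume BB := by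
        simp only [SS_vol, ENNReal.tsum_mul_right, zero_add]
      _ ≤ _ := by gcongr; exact kraft
  lift volume BB to NNReal using hfin with r
  rw [← ENNReal.ofReal_coe_nnreal, ← ENNReal.ofReal_mul (by norm_num),
    ENNReal.ofReal_le_ofReal_iff (by positivity)] at h
  have : (r : ℝ) = 0 := le_antisymm (by linarith) r.2
  have : r = 0 := by exact_mod_cast this
  simp [this]

/-- For Lebesgue-almost every `y ∈ [0, 2/3]`, the level set `L(y)` is finite. -/
theorem levelSet_finite_ae :
    ∀ᵐ y ∂(MeasureTheory.volume.restrict (Set.Icc (0 : ℝ) (2 / 3))),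
      (levelSet y).Finite := by
  apply ae_restrict_of_ae
  exact BB_null
end

section
/- The deficient digit set Ω^L has Hausdorff dimension 1. -/
open MeasureTheory Set

/-- Number of ones among the last `m` binary digits of `c`. -/
def pcount : ℕ → ℤ → ℤ
  | 0, _ => 0
  | m + 1, c => pcount m (c / 2) + c % 2

lemma pcount_compl (m : ℕ) (c : ℤ) : pcount m (2 ^ m - 1 - c) = m - pcount m c := by
  induction m generalizing c with
  | zero => simp [pcount]
  | succ m ih =>
    have h1 : ((2 : ℤ) ^ (m + 1) - 1 - c) / 2 = 2 ^ m - 1 - c / 2 := by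
      rw [pow_succ]; omega
    have h2 : ((2 : ℤ) ^ (m + 1) - 1 - c) % 2 = 1 - c % 2 := by
      rw [pow_succ]; omega
    simp only [pcount, h1, h2, ih]
    push_cast; ring

lemma floor_two_mul_div (t : ℝ) : ⌊2 * t⌋ / 2 = ⌊t⌋ := by
  have h1 := Int.floor_le t
  have h2 := Int.lt_floor_add_one t
  have h3 : 2 * ⌊t⌋ ≤ ⌊2 * t⌋ := by
    rw [Int.le_floor]; push_cast; linarith
  have h4 : ⌊2 * t⌋ < 2 * ⌊t⌋ + 2 := by
    rw [Int.floor_lt]; push_cast; linarith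
  omega

lemma bdigit_succ (x : ℝ) (j : ℕ) : bdigit x (j + 1) = ⌊(2 : ℝ) ^ (j + 1) * x⌋ % 2 := by
  have := floor_two_mul_div ((2 : ℝ) ^ j * x)
  rw [← mul_assoc, ← pow_succ'] at this
  simp only [bdigit, Nat.add_sub_cancel]
  omega

lemma defDigit_zero (x : ℝ) : defDigit x 0 = 0 := by simp [defDigit]

lemma defDigit_succ (x : ℝ) (j : ℕ) :
    defDigit x (j + 1) = defDigit x j + 1 - 2 * bdigit x (j + 1) := by
  simp only [defDigit]
  rw [Finset.sum_Icc_succ_top (by omega)]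
  push_cast; ring

lemma defDigit_eq (x : ℝ) (hx : x ∈ Set.Ico (0 : ℝ) 1) (m : ℕ) :
    defDigit x m = m - 2 * pcount m ⌊(2 : ℝ) ^ m * x⌋ := by
  induction m with
  | zero => simp [defDigit_zero, pcount]
  | succ m ih =>
    have := floor_two_mul_div ((2 : ℝ) ^ m * x)
    rw [← mul_assoc, ← pow_succ'] at this
    rw [defDigit_succ, ih, bdigit_succ, pcount, this]
    push_cast; ring

lemma neg_le_defDigit (x : ℝ) (j : ℕ) : -(j : ℤ) ≤ defDigit x j := by
  induction j with
  | zero => simp [defDigit_zero]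
  | succ j ih =>
    rw [defDigit_succ, bdigit_succ]
    push_cast
    omega

lemma defDigit_add (x t : ℝ) (k : ℤ) (m : ℕ) (h : (2 : ℝ) ^ m * x = k + t) (j : ℕ) :
    defDigit x (m + j) = defDigit x m + defDigit t j := by
  induction j with
  | zero => simp [defDigit_zero]
  | succ j ih =>
    rw [← add_assoc, defDigit_succ, defDigit_succ, ih, bdigit_succ, bdigit_succ]
    have : (2 : ℝ) ^ (m + j + 1) * x = ((2 * (2 ^ j * k) : ℤ) : ℝ) + 2 ^ (j + 1) * t := by
      have : (2 : ℝ) ^ (m + j + 1) * x = 2 ^ (j + 1) * (2 ^ m * x) := by ring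
      rw [this, h]; push_cast; ring
    rw [this, Int.floor_intCast_add]
    omega

/-- Block code. -/
def codeN (n : ℕ) (w : ℕ) : ℕ :=
  if 2 * pcount n (w : ℤ) ≤ n then 4 * w else 4 * (2 ^ n - 1 - w) + 2

lemma codeN_lt (n w : ℕ) (hw : w < 2 ^ n) : codeN n w + 2 ≤ 2 ^ (n + 2) := by
  have : 2 ^ (n + 2) = 4 * 2 ^ n := by ring
  unfold codeN
  split_ifs <;> omega

lemma codeN_even (n w : ℕ) : 2 ∣ codeN n w := by
  unfold codeN
  split_ifs <;> omega

lemma codeN_inj (n w v : ℕ) (hw : w < 2 ^ n) (hv : v < 2 ^ n) (h : codeN n w = codeN n v) :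
    w = v := by
  unfold codeN at h
  split_ifs at h <;> omega

lemma codeN_pcount (n w : ℕ) (hw : w < 2 ^ n) :
    2 * pcount (n + 2) (codeN n w : ℤ) ≤ (n + 2 : ℕ) := by
  have key : ∀ v : ℤ, pcount (n + 2) (4 * v) = pcount n v := by
    intro v
    have h1 : 4 * v / 2 / 2 = v := by omega
    have h2 : 4 * v / 2 % 2 = 0 := by omega
    have h3 : 4 * v % 2 = 0 := by omega
    simp [pcount, h1, h2, h3]
  have key2 : ∀ v : ℤ, pcount (n + 2) (4 * v + 2) = pcount n v + 1 := by
    intro v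
    have h1 : (4 * v + 2) / 2 / 2 = v := by omega
    have h2 : (4 * v + 2) / 2 % 2 = 1 := by omega
    have h3 : (4 * v + 2) % 2 = 0 := by omega
    simp only [pcount, h1, h2, h3]; ring
  unfold codeN
  split_ifs with h
  · push_cast
    rw [key]; omega
  · have e : ((4 * (2 ^ n - 1 - w) + 2 : ℕ) : ℤ) = 4 * (2 ^ n - 1 - (w : ℤ)) + 2 := by
      have : ((2 ^ n - 1 - w : ℕ) : ℤ) = 2 ^ n - 1 - (w : ℤ) := by
        rw [Nat.sub_sub, Nat.cast_sub (by omega)]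
        push_cast; ring
      rw [Nat.cast_add, Nat.cast_mul, this]; norm_num
    rw [e, key2, pcount_compl]
    push_cast
    omega

/-- Block code on `Fin`. -/
def codeF (n : ℕ) (w : Fin (2 ^ n)) : Fin (2 ^ (n + 2)) :=
  ⟨codeN n w, by have := codeN_lt n w w.2; omega⟩

/-- The encoded real number. -/
noncomputable def encX (n : ℕ) (w : ℕ → Fin (2 ^ n)) : ℝ :=
  Real.ofDigits (fun i => codeF n (w i))

lemma encX_step (n : ℕ) (w : ℕ → Fin (2 ^ n)) :
    (2 : ℝ) ^ (n + 2) * encX n w = (codeN n (w 0) : ℝ) + encX n (fun i => w (i + 1)) := by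
  unfold encX
  rw [Real.ofDigits_eq_sum_add_ofDigits _ 1]
  simp only [Finset.sum_range_one, Real.ofDigitsTerm, codeF]
  push_cast
  field_simp

lemma encX_mem (n : ℕ) (w : ℕ → Fin (2 ^ n)) : encX n w ∈ Set.Ico (0 : ℝ) 1 := by
  refine ⟨Real.ofDigits_nonneg _, ?_⟩
  have h := encX_step n w
  have h1 : encX n (fun i => w (i + 1)) ≤ 1 := Real.ofDigits_le_one _
  have h2 : ((codeN n (w 0) : ℝ)) + 2 ≤ 2 ^ (n + 2) := by
    exact_mod_cast codeN_lt n (w 0) (w 0).2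
  have h3 : (0 : ℝ) < 2 ^ (n + 2) := by positivity
  by_contra hc
  push Not at hc
  nlinarith

lemma encX_floor (n : ℕ) (w : ℕ → Fin (2 ^ n)) :
    ⌊(2 : ℝ) ^ (n + 2) * encX n w⌋ = (codeN n (w 0) : ℤ) := by
  rw [encX_step, Int.floor_natCast_add]
  have := encX_mem n (fun i => w (i + 1))
  rw [Int.floor_eq_zero_iff.2 this]; simp

lemma encX_def (n : ℕ) (j : ℕ) (w : ℕ → Fin (2 ^ n)) :
    -((n + 2 : ℕ) : ℤ) ≤ defDigit (encX n w) j := by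
  induction j using Nat.strong_induction_on generalizing w with
  | _ j ih =>
    rcases lt_or_ge j (n + 2) with hj | hj
    · have := neg_le_defDigit (encX n w) j
      omega
    · obtain ⟨i, rfl⟩ := Nat.exists_eq_add_of_le hj
      rw [defDigit_add _ (encX n (fun i => w (i + 1))) (codeN n (w 0)) (n + 2)
        (by rw [encX_step]; simp) i]
      have h1 := ih i (by omega) (fun i => w (i + 1))
      have h2 := codeN_pcount n (w 0) (w 0).2
      rw [defDigit_eq _ (encX_mem n w), encX_floor]
      omega

lemma encX_div_mem (n : ℕ) (w : ℕ → Fin (2 ^ n)) : encX n w / 2 ^ (n + 2) ∈ OmegaL := by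
  have hm := encX_mem n w
  have hI : encX n w / 2 ^ (n + 2) ∈ Set.Ico (0 : ℝ) 1 := by
    refine ⟨div_nonneg hm.1 (by positivity), ?_⟩
    rw [div_lt_one (by positivity)]
    exact hm.2.trans_le (one_le_pow₀ (by norm_num))
  refine ⟨hI, fun j _ => ?_⟩
  have hz : ∀ i, i ≤ n + 2 → defDigit (encX n w / 2 ^ (n + 2)) i = i := by
    intro i
    induction i with
    | zero => simp [defDigit_zero]
    | succ i ih =>
      intro hi
      rw [defDigit_succ, ih (by omega), bdigit_succ]
      have : ⌊(2 : ℝ) ^ (i + 1) * (encX n w / 2 ^ (n + 2))⌋ = 0 := by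
        rw [Int.floor_eq_zero_iff]
        refine ⟨mul_nonneg (by positivity) hI.1, ?_⟩
        rw [mul_div_assoc', div_lt_one (by positivity)]
        calc (2 : ℝ) ^ (i + 1) * encX n w < 2 ^ (i + 1) * 1 := by
              gcongr; exact hm.2
          _ ≤ 2 ^ (n + 2) := by
              rw [mul_one]; exact pow_le_pow_right₀ (by norm_num) hi
      rw [this]; push_cast; ring
  rcases le_total j (n + 2) with hj | hj
  · rw [hz j hj]; omega
  · obtain ⟨i, rfl⟩ := Nat.exists_eq_add_of_le hj
    rw [defDigit_add _ (encX n w) 0 (n + 2) (by push_cast; field_simp; ring) i, hz _ le_rfl]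
    have := encX_def n i w
    omega

lemma encX_sep (n k : ℕ) (w v : ℕ → Fin (2 ^ n)) (h : ∀ i < k, w i = v i) (hk : w k ≠ v k) :
    (((2 : ℝ) ^ (n + 2)) ^ (k + 1))⁻¹ ≤ |encX n w - encX n v| := by
  induction k generalizing w v with
  | zero =>
    have hw := encX_step n w
    have hv := encX_step n v
    have hw1 := encX_mem n (fun i => w (i + 1))
    have hv1 := encX_mem n (fun i => v (i + 1))
    have hP : (0 : ℝ) < 2 ^ (n + 2) := by positivity
    rw [zero_add, pow_one, inv_le_iff_one_le_mul₀' hP]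
    rw [show (2 : ℝ) ^ (n + 2) * |encX n w - encX n v| = |2 ^ (n + 2) * (encX n w - encX n v)| by
      rw [abs_mul, abs_of_pos hP], mul_sub, hw, hv, le_abs]
    have hne : codeN n (w 0) ≠ codeN n (v 0) := fun e =>
      hk (Fin.ext (codeN_inj n _ _ (w 0).2 (v 0).2 e))
    obtain ⟨a, ha⟩ := codeN_even n (w 0)
    obtain ⟨b, hb⟩ := codeN_even n (v 0)
    rcases lt_or_gt_of_ne hne with hl | hl
    · right
      have : (codeN n (w 0) : ℝ) + 2 ≤ codeN n (v 0) := by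
        exact_mod_cast (by omega : codeN n (w 0) + 2 ≤ codeN n (v 0))
      linarith [hw1.1, hw1.2, hv1.1, hv1.2]
    · left
      have : (codeN n (v 0) : ℝ) + 2 ≤ codeN n (w 0) := by
        exact_mod_cast (by omega : codeN n (v 0) + 2 ≤ codeN n (w 0))
      linarith [hw1.1, hw1.2, hv1.1, hv1.2]
  | succ k ih =>
    have hw := encX_step n w
    have hv := encX_step n v
    have hP : (0 : ℝ) < 2 ^ (n + 2) := by positivity
    have := ih (fun i => w (i + 1)) (fun i => v (i + 1)) (fun i hi => h (i + 1) (by omega)) hk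
    have e : encX n (fun i => w (i + 1)) - encX n (fun i => v (i + 1))
        = 2 ^ (n + 2) * (encX n w - encX n v) := by
      rw [h 0 (by omega)] at hw
      linarith
    rw [e, abs_mul, abs_of_pos hP] at this
    rw [pow_succ, mul_inv, ← div_eq_mul_inv, div_le_iff₀' hP]
    exact this

lemma enc_holder (n : ℕ) (w v : ℕ → Fin (2 ^ n)) :
    |Real.ofDigits w - Real.ofDigits v| ≤
      2 ^ n * |encX n w - encX n v| ^ ((n : ℝ) / (n + 2)) := by
  by_cases hwv : w = v
  · subst hwv
    simp only [sub_self, abs_zero]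
    positivity
  · have hex : ∃ k, w k ≠ v k := by
      by_contra hc
      push Not at hc
      exact hwv (funext hc)
    classical
    have hk := Nat.find_spec hex
    have hlt : ∀ i < Nat.find hex, w i = v i := fun i hi => not_not.1 (Nat.find_min hex hi)
    generalize Nat.find hex = k at hk hlt
    have h1 := Real.abs_ofDigits_sub_ofDigits_le hlt
    have h2 := encX_sep n k w v hlt hk
    have hr : (0 : ℝ) ≤ (n : ℝ) / (n + 2) := by positivity
    have h3 := Real.rpow_le_rpow (by positivity) h2 hr
    have h4 : ((((2 : ℝ) ^ (n + 2)) ^ (k + 1))⁻¹) ^ ((n : ℝ) / (n + 2))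
        = (((2 : ℝ) ^ n) ^ (k + 1))⁻¹ := by
      rw [Real.inv_rpow (by positivity), ← pow_mul, ← pow_mul, ← Real.rpow_natCast,
        ← Real.rpow_natCast, ← Real.rpow_mul (by norm_num)]
      congr 2
      push_cast
      field_simp
    rw [h4] at h3
    calc _ ≤ _ := h1
      _ = 2 ^ n * (((2 : ℝ) ^ n) ^ (k + 1))⁻¹ := by
        push_cast; field_simp; ring
      _ ≤ _ := by gcongr

lemma dimH_range_encX (n : ℕ) (hn : 1 ≤ n) :
    (((n : NNReal) / (n + 2) : NNReal) : ENNReal) ≤ dimH (Set.range (encX n)) := by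
  have hr : (0 : NNReal) < (n : NNReal) / (n + 2) := by
    have : (0 : NNReal) < n := by exact_mod_cast hn
    positivity
  have : Nonempty (Fin (2 ^ n)) := ⟨⟨0, by positivity⟩⟩
  set f : ℝ → ℝ := fun x => Real.ofDigits (Function.invFun (encX n) x) with hf
  have key : ∀ w v, |Real.ofDigits w - Real.ofDigits v| ≤
      2 ^ n * |encX n w - encX n v| ^ ((n : ℝ) / (n + 2)) := enc_holder n
  have hfw : ∀ w, f (encX n w) = Real.ofDigits w := by
    intro w
    have h1 : encX n (Function.invFun (encX n) (encX n w)) = encX n w :=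
      Function.invFun_eq ⟨w, rfl⟩
    have h2 := key (Function.invFun (encX n) (encX n w)) w
    have h3 : (n : ℝ) / (n + 2) ≠ 0 := by
      have : (0 : ℝ) < n := by exact_mod_cast hn
      positivity
    rw [h1, sub_self, abs_zero, Real.zero_rpow h3, mul_zero] at h2
    exact sub_eq_zero.1 (abs_nonpos_iff.1 h2)
  have hH : HolderOnWith ((2 : NNReal) ^ n) ((n : NNReal) / (n + 2)) f (Set.range (encX n)) := by
    rintro _ ⟨w, rfl⟩ _ ⟨v, rfl⟩
    rw [hfw, hfw, edist_dist, edist_dist, Real.dist_eq, Real.dist_eq,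
      ENNReal.ofReal_rpow_of_nonneg (abs_nonneg _) (by positivity)]
    have : (((2 : NNReal) ^ n : NNReal) : ENNReal) = ENNReal.ofReal ((2 : ℝ) ^ n) := by
      rw [ENNReal.ofReal_pow (by norm_num)]; simp
    rw [this, ← ENNReal.ofReal_mul (by positivity)]
    apply ENNReal.ofReal_le_ofReal
    simpa using key w v
  have h1 := hH.dimH_image_le hr
  have h2 : Set.Icc (0 : ℝ) 1 ⊆ f '' Set.range (encX n) := by
    intro y hy
    obtain ⟨w, -, hw⟩ := Real.ofDigits_SurjOn (b := 2 ^ n)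
      (Nat.one_lt_two_pow (by omega)) hy
    exact ⟨encX n w, ⟨w, rfl⟩, by rw [hfw, hw]⟩
  have h3 : dimH (Set.Icc (0 : ℝ) 1) = 1 := by
    rw [Real.dimH_of_nonempty_interior (by simp)]
    simp
  have h4 := (dimH_mono h2).trans h1
  rw [h3, ENNReal.le_div_iff_mul_le (Or.inl (by simpa using hr.ne'))
    (Or.inl ENNReal.coe_ne_top), one_mul] at h4
  exact h4

lemma dimH_OmegaL_ge (n : ℕ) (hn : 1 ≤ n) :
    (((n : NNReal) / (n + 2) : NNReal) : ENNReal) ≤ dimH OmegaL := by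
  refine (dimH_range_encX n hn).trans ?_
  have hsub : Set.range (encX n) ⊆ (fun x : ℝ => ((2 : ℝ) ^ (n + 2)) • x) '' OmegaL := by
    rintro _ ⟨w, rfl⟩
    refine ⟨_, encX_div_mem n w, ?_⟩
    simp only [smul_eq_mul]
    field_simp
  exact (dimH_mono hsub).trans ((lipschitzWith_smul ((2 : ℝ) ^ (n + 2))).dimH_image_le _)

/-- The deficient digit set has Hausdorff dimension `1`. -/
theorem dimH_OmegaL : dimH OmegaL = 1 := by
  apply le_antisymm
  · rw [← Real.dimH_univ]; exact dimH_mono (Set.subset_univ _)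
  · have ht : Filter.Tendsto (fun n : ℕ => (((n : NNReal) / (n + 2) : NNReal) : ENNReal))
        Filter.atTop (nhds ((1 : NNReal) : ENNReal)) := by
      rw [ENNReal.tendsto_coe, ← NNReal.tendsto_coe]
      push_cast
      exact tendsto_natCast_div_add_atTop (2 : ℝ)
    rw [ENNReal.coe_one] at ht
    refine le_of_tendsto ht ?_
    filter_upwards [Filter.eventually_ge_atTop 1] with n hn
    exact dimH_OmegaL_ge n hn
end

section
/- The set Γ_H^abs = {x ∈ [0,1] : dim_H(L(τ(x))) > 0} of abscissas whose Takagi level set has positive Hausdorff dimension has full Hausdorff dimension: dim_H(Γ_H^abs) = 1. -/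
open MeasureTheory Set

namespace TakagiAux

lemma dni_nonneg (t : ℝ) : 0 ≤ distNearestInt t := abs_nonneg _

lemma dni_le (t : ℝ) : distNearestInt t ≤ 1 / 2 := abs_sub_round t

lemma dni_add_int (t : ℝ) (n : ℤ) : distNearestInt (t + n) = distNearestInt t := by
  unfold distNearestInt
  rw [abs_sub_round_eq_min, abs_sub_round_eq_min, Int.fract_add_intCast]

lemma dni_eq_left {t : ℝ} (h0 : 0 ≤ t) (h1 : t ≤ 1 / 2) : distNearestInt t = t := by
  unfold distNearestInt
  rw [abs_sub_round_eq_min, Int.fract_eq_self.2 ⟨h0, by linarith⟩]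
  exact min_eq_left (by linarith)

lemma dni_eq_right {t : ℝ} (h0 : 1 / 2 ≤ t) (h1 : t ≤ 1) : distNearestInt t = 1 - t := by
  rcases h1.eq_or_lt with rfl | h1
  · unfold distNearestInt
    simp
  unfold distNearestInt
  rw [abs_sub_round_eq_min, Int.fract_eq_self.2 ⟨by linarith, h1⟩]
  exact min_eq_right (by linarith)

lemma dni_neg (t : ℝ) : distNearestInt (-t) = distNearestInt t := by
  unfold distNearestInt
  rw [abs_sub_round_eq_min, abs_sub_round_eq_min]
  by_cases h : Int.fract t = 0
  · rw [Int.fract_neg_eq_zero.2 h, h]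
  · rw [Int.fract_neg h, min_comm]
    congr 1
    ring

lemma summable_takagi (x : ℝ) : Summable (fun n : ℕ => distNearestInt (2 ^ n * x) / 2 ^ n) := by
  refine Summable.of_nonneg_of_le (fun n => div_nonneg (dni_nonneg _) (by positivity))
    (fun n => ?_) (summable_geometric_two)
  rw [one_div_pow]
  have := dni_le (2 ^ n * x)
  gcongr
  linarith

lemma takagi_nonneg (x : ℝ) : 0 ≤ takagi x :=
  tsum_nonneg (fun n => div_nonneg (dni_nonneg _) (by positivity))

lemma takagi_le (x : ℝ) : takagi x ≤ 2 := by
  rw [← tsum_geometric_two]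
  refine (summable_takagi x).tsum_le_tsum (fun n => ?_) summable_geometric_two
  rw [one_div_pow]
  have := dni_le (2 ^ n * x)
  gcongr
  linarith

lemma takagi_step (x : ℝ) : takagi x = distNearestInt x + takagi (2 * x) / 2 := by
  unfold takagi
  rw [(summable_takagi x).tsum_eq_zero_add, ← tsum_div_const]
  simp only [pow_zero, one_mul, div_one]
  congr 1
  refine tsum_congr fun n => ?_
  rw [pow_succ, mul_assoc, div_div]

lemma takagi_add_int (x : ℝ) (m : ℤ) : takagi (x + m) = takagi x := by
  unfold takagi
  refine tsum_congr fun n => ?_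
  congr 1
  rw [← dni_add_int (2 ^ n * x) (2 ^ n * m)]
  congr 1
  push_cast
  ring

lemma takagi_neg (x : ℝ) : takagi (-x) = takagi x := by
  unfold takagi
  refine tsum_congr fun n => ?_
  rw [mul_neg, dni_neg]

lemma takagi_one_sub (x : ℝ) : takagi (1 - x) = takagi x := by
  rw [← takagi_neg x, ← takagi_add_int (-x) 1]
  congr 1
  push_cast
  ring

lemma takagi_zero : takagi 0 = 0 := by
  simp [takagi, distNearestInt]

lemma takagi_lin (m : ℕ) : ∀ S : Finset ℕ, S ⊆ Finset.range m → ∃ c : ℝ, ∀ t ∈ Icc (0:ℝ) 1,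
    takagi (((∑ i ∈ S, 2 ^ i : ℕ) + t) / 2 ^ m) =
      c + ((m:ℝ) - 2 * S.card) * t / 2 ^ m + takagi t / 2 ^ m := by
  induction m with
  | zero =>
    intro S hS
    have : S = ∅ := by simpa using hS
    subst this
    exact ⟨0, fun t _ => by simp⟩
  | succ m ih =>
    intro S hS
    have hbd : ∀ S' : Finset ℕ, S' ⊆ Finset.range m → ((∑ i ∈ S', 2 ^ i : ℕ) : ℝ) + 1 ≤ 2 ^ m := by
      intro S' h
      have h1 : ∑ i ∈ S', 2 ^ i ≤ ∑ i ∈ Finset.range m, 2 ^ i :=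
        Finset.sum_le_sum_of_subset h
      have h2 := Nat.geomSum_eq (le_refl 2) m
      have h3 : 0 < 2 ^ m := by positivity
      have : (∑ i ∈ S', 2 ^ i) + 1 ≤ 2 ^ m := by
        rw [h2] at h1; simp at h1; omega
      exact_mod_cast this
    have hp : (0:ℝ) < 2 ^ m := by positivity
    by_cases hm : m ∈ S
    · have hS' : S.erase m ⊆ Finset.range m := by
        intro i hi
        have h1 := hS (Finset.mem_of_mem_erase hi)
        have h2 := Finset.ne_of_mem_erase hi
        simp at h1 ⊢
        omega
      obtain ⟨c, hc⟩ := ih _ hS'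
      have hb := hbd _ hS'
      have hsum : ((∑ i ∈ S, 2 ^ i : ℕ) : ℝ) = (∑ i ∈ S.erase m, 2 ^ i : ℕ) + 2 ^ m := by
        rw [← Finset.sum_erase_add _ _ hm]; push_cast; rfl
      have hcard : (S.card : ℝ) = (S.erase m).card + 1 := by
        rw [← Finset.card_erase_add_one hm]; push_cast; rfl
      set w : ℝ := ((∑ i ∈ S.erase m, 2 ^ i : ℕ) : ℝ) with hw
      have hw0 : 0 ≤ w := Nat.cast_nonneg _
      refine ⟨1 - (w + 2 ^ m) / 2 ^ (m + 1) + c / 2, fun t ht => ?_⟩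
      rw [takagi_step, hsum, hcard, dni_eq_right]
      · have : 2 * ((w + 2 ^ m + t) / 2 ^ (m + 1)) = (w + t) / 2 ^ m + (1 : ℤ) := by
          push_cast; field_simp; ring
        rw [this, takagi_add_int, hc t ht]
        push_cast
        field_simp
        ring
      · rw [pow_succ, div_le_div_iff₀ (by norm_num) (by positivity)]
        nlinarith [ht.1]
      · rw [pow_succ, div_le_one (by positivity)]
        linarith [ht.2]
    · have hS' : S ⊆ Finset.range m := by
        intro i hi
        have h1 := hS hi
        have h2 : i ≠ m := fun h => hm (h ▸ hi)
        simp at h1 ⊢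
        omega
      obtain ⟨c, hc⟩ := ih _ hS'
      have hb := hbd _ hS'
      set w : ℝ := ((∑ i ∈ S, 2 ^ i : ℕ) : ℝ) with hw
      have hw0 : 0 ≤ w := Nat.cast_nonneg _
      refine ⟨w / 2 ^ (m + 1) + c / 2, fun t ht => ?_⟩
      rw [takagi_step, dni_eq_left]
      · have : 2 * ((w + t) / 2 ^ (m + 1)) = (w + t) / 2 ^ m := by
          field_simp; ring
        rw [this, hc t ht]
        push_cast
        field_simp
        ring
      · exact div_nonneg (add_nonneg hw0 ht.1) (by positivity)
      · rw [pow_succ, div_le_div_iff₀ (by positivity) (by norm_num)]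
        linarith [ht.2]

/-- Good digits in base `B`. -/
def Good (B : ℕ) (w : ℕ) : Prop :=
  (1 ≤ w ∧ w + 2 ≤ B) ∧ ∀ t ∈ Icc (0:ℝ) 1, takagi ((w + t) / B) = takagi (w / B) + takagi t / B

lemma Good.flip {B w : ℕ} (h : Good B w) :
    Good B (B - 1 - w) ∧ takagi ((B - 1 - w : ℕ) / B) = takagi (w / B) := by
  obtain ⟨⟨h1, h2⟩, h3⟩ := h
  have hB : (0:ℝ) < B := by exact_mod_cast (by omega : 0 < B)
  have hc : ((B - 1 - w : ℕ) : ℝ) = B - 1 - w := by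
    rw [Nat.sub_sub, Nat.cast_sub (by omega)]; push_cast; ring
  have key : ∀ t ∈ Icc (0:ℝ) 1,
      takagi (((B - 1 - w : ℕ) + t) / B) = takagi (w / B) + takagi t / B := by
    intro t ht
    have := h3 (1 - t) ⟨by linarith [ht.2], by linarith [ht.1]⟩
    rw [takagi_one_sub] at this
    rw [← this, ← takagi_one_sub, hc]
    congr 1
    field_simp
    ring
  have h0 : takagi ((B - 1 - w : ℕ) / B) = takagi (w / B) := by
    have := key 0 (by simp)
    simpa [takagi_zero] using this
  refine ⟨⟨⟨by omega, by omega⟩, fun t ht => ?_⟩, h0⟩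
  rw [h0, key t ht]

lemma good_of_card {k : ℕ} (hk : 1 ≤ k) {S : Finset ℕ} (hS : S ⊆ Finset.range (2 * k))
    (hc : S.card = k) : Good (2 ^ (2 * k)) (∑ i ∈ S, 2 ^ i) := by
  refine ⟨⟨?_, ?_⟩, ?_⟩
  · obtain ⟨i, hi⟩ : S.Nonempty := Finset.card_pos.1 (by omega)
    calc 1 ≤ 2 ^ i := Nat.one_le_two_pow
      _ ≤ _ := Finset.single_le_sum (f := fun i => 2 ^ i) (fun _ _ => Nat.zero_le _) hi
  · have h1 : ∑ i ∈ S, 2 ^ i ≤ ∑ i ∈ Finset.range (2 * k), 2 ^ i := Finset.sum_le_sum_of_subset hS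
    have h2 := Nat.geomSum_eq (le_refl 2) (2 * k)
    have h3 : 0 < 2 ^ (2 * k) := by positivity
    have h4 : ∑ i ∈ S, 2 ^ i ≠ ∑ i ∈ Finset.range (2 * k), 2 ^ i := by
      intro h
      have := Finset.geomSum_injective (le_refl 2) h
      rw [this] at hc
      simp at hc
      omega
    rw [h2] at h1 h4
    simp at h1 h4
    omega
  · intro t ht
    obtain ⟨c, h⟩ := takagi_lin (2 * k) S hS
    have h0 := h 0 (by simp)
    have h1 := h t ht
    rw [hc] at h0 h1
    push_cast at h0 h1 ⊢
    simp [takagi_zero] at h0 h1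
    rw [h0, h1]

lemma ofDigits_cons {B : ℕ} (a : ℕ → Fin B) :
    Real.ofDigits a = ((a 0 : ℕ) + Real.ofDigits (fun i => a (i + 1))) / B := by
  rw [Real.ofDigits_eq_sum_add_ofDigits a 1]
  simp [Real.ofDigitsTerm]
  ring

lemma takagi_eq {B : ℕ} (hB : 2 ≤ B) (a b : ℕ → Fin B) (ha : ∀ j, Good B (a j))
    (hb : ∀ j, Good B (b j))
    (h : ∀ j, takagi ((a j : ℕ) / B) = takagi ((b j : ℕ) / B)) :
    takagi (Real.ofDigits a) = takagi (Real.ofDigits b) := by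
  have key : ∀ n, takagi (Real.ofDigits a) - takagi (Real.ofDigits b) =
      (takagi (Real.ofDigits (fun i => a (i + n))) - takagi (Real.ofDigits (fun i => b (i + n))))
        / (B:ℝ) ^ n := by
    intro n
    induction n with
    | zero => simp
    | succ n ih =>
      rw [ih, ofDigits_cons (fun i => a (i + n)), ofDigits_cons (fun i => b (i + n)),
        (ha _).2 _ ⟨Real.ofDigits_nonneg _, Real.ofDigits_le_one _⟩,
        (hb _).2 _ ⟨Real.ofDigits_nonneg _, Real.ofDigits_le_one _⟩, h]
      simp only [add_assoc, add_comm 1 n]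
      have : (B:ℝ) ≠ 0 := by positivity
      field_simp
      ring
  have hlim : Filter.Tendsto (fun n : ℕ => (2:ℝ) * ((B:ℝ)⁻¹) ^ n) Filter.atTop (nhds (2 * 0)) := by
    apply Filter.Tendsto.const_mul
    apply tendsto_pow_atTop_nhds_zero_of_lt_one (by positivity)
    apply inv_lt_one_of_one_lt₀
    exact_mod_cast hB
  have hle : |takagi (Real.ofDigits a) - takagi (Real.ofDigits b)| ≤ 2 * 0 := by
    refine ge_of_tendsto' hlim fun n => ?_
    rw [key n, abs_div, abs_of_nonneg (by positivity : (0:ℝ) ≤ (B:ℝ) ^ n), inv_pow, div_eq_mul_inv]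
    gcongr
    rw [abs_le]
    constructor <;> linarith [takagi_nonneg (Real.ofDigits (fun i => a (i + n))),
      takagi_nonneg (Real.ofDigits (fun i => b (i + n))), takagi_le (Real.ofDigits (fun i => a (i + n))),
      takagi_le (Real.ofDigits (fun i => b (i + n)))]
  rw [mul_zero] at hle
  have := abs_nonpos_iff.1 hle
  linarith

lemma sep_aux {B : ℕ} (u v : ℕ → Fin B) (hu : ∀ j, 1 ≤ (u j : ℕ) ∧ (u j : ℕ) + 2 ≤ B)
    (hv : ∀ j, 1 ≤ (v j : ℕ) ∧ (v j : ℕ) + 2 ≤ B) (h : u 0 < v 0) :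
    ((B:ℝ) ^ 2)⁻¹ ≤ Real.ofDigits v - Real.ofDigits u := by
  have hB : (3:ℝ) ≤ B := by exact_mod_cast (by have := hu 0; omega : 3 ≤ B)
  have h1 : (1:ℝ) / B ≤ Real.ofDigits (fun i => v (i + 1)) := by
    rw [ofDigits_cons]
    have : (1:ℝ) ≤ (v 1 : ℕ) := by exact_mod_cast (hv 1).1
    have := Real.ofDigits_nonneg (fun i => v (i + 1 + 1))
    gcongr
    simp
    linarith
  have h2 : Real.ofDigits (fun i => u (i + 1)) ≤ 1 := Real.ofDigits_le_one _
  have h3 : ((u 0 : ℕ) : ℝ) + 1 ≤ (v 0 : ℕ) := by exact_mod_cast h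
  rw [ofDigits_cons v, ofDigits_cons u, ← sub_div, le_div_iff₀ (by positivity)]
  have : ((B:ℝ) ^ 2)⁻¹ * B = 1 / B := by field_simp
  rw [this]
  linarith

lemma sep {B : ℕ} (u v : ℕ → Fin B) (hu : ∀ j, 1 ≤ (u j : ℕ) ∧ (u j : ℕ) + 2 ≤ B)
    (hv : ∀ j, 1 ≤ (v j : ℕ) ∧ (v j : ℕ) + 2 ≤ B) (n : ℕ) (he : ∀ i < n, u i = v i)
    (h : u n ≠ v n) :
    ((B:ℝ) ^ n)⁻¹ * ((B:ℝ) ^ 2)⁻¹ ≤ |Real.ofDigits u - Real.ofDigits v| := by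
  rw [Real.ofDigits_eq_sum_add_ofDigits u n, Real.ofDigits_eq_sum_add_ofDigits v n]
  have : ∑ i ∈ Finset.range n, Real.ofDigitsTerm u i = ∑ i ∈ Finset.range n, Real.ofDigitsTerm v i :=
    Finset.sum_congr rfl fun i hi ↦ by simp [Real.ofDigitsTerm, he i (Finset.mem_range.mp hi)]
  rw [this, add_sub_add_left_eq_sub, ← mul_sub, abs_mul,
    abs_of_nonneg (by positivity : (0:ℝ) ≤ ((B:ℝ) ^ n)⁻¹)]
  gcongr
  rcases lt_or_gt_of_ne h with h | h
  · rw [abs_sub_comm]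
    exact (sep_aux (fun i => u (i + n)) (fun i => v (i + n)) (fun _ => hu _) (fun _ => hv _)
      (by simpa using h)).trans (le_abs_self _)
  · exact (sep_aux (fun i => v (i + n)) (fun i => u (i + n)) (fun _ => hv _) (fun _ => hu _)
      (by simpa using h)).trans (le_abs_self _)

lemma dim_lower {B N : ℕ} (hN : 2 ≤ N) (s : NNReal) (hs : 0 < s) (hBN : (B:ℝ) ^ (s:ℝ) ≤ N)
    (d : ℕ → Fin N → Fin B) (hinj : ∀ j, Function.Injective (d j))
    (hd : ∀ j x, 1 ≤ (d j x : ℕ) ∧ (d j x : ℕ) + 2 ≤ B) :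
    (s : ENNReal) ≤ dimH (range fun a : ℕ → Fin N => Real.ofDigits (fun j => d j (a j))) := by
  set F : (ℕ → Fin N) → ℝ := fun a => Real.ofDigits (fun j => d j (a j)) with hF
  have hB : (0:ℝ) < B := by
    have := hd 0 ⟨0, by omega⟩
    exact_mod_cast (by omega : 0 < B)
  have hne : Nonempty (ℕ → Fin N) := ⟨fun _ => ⟨0, by omega⟩⟩
  have key : ∀ a b : ℕ → Fin N, |Real.ofDigits a - Real.ofDigits b| ≤
      ((B:ℝ) ^ 2) ^ (s:ℝ) * |F a - F b| ^ (s:ℝ) := by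
    intro a b
    by_cases hab : a = b
    · subst hab
      simp
      positivity
    have hex : ∃ n, a n ≠ b n := Function.ne_iff.1 hab
    classical
    have h1 := Nat.find_spec hex
    have h2 : ∀ i < Nat.find hex, a i = b i := fun i hi => not_not.1 (Nat.find_min hex hi)
    set n := Nat.find hex
    have h3 := Real.abs_ofDigits_sub_ofDigits_le h2
    have h4 := sep (fun j => d j (a j)) (fun j => d j (b j)) (fun j => hd j _) (fun j => hd j _) n
      (fun i hi => by simp only [h2 i hi]) (fun h => h1 (hinj n h))
    refine h3.trans ?_
    rw [← Real.mul_rpow (by positivity) (abs_nonneg _)]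
    have h5 : ((B:ℝ) ^ n)⁻¹ ≤ (B:ℝ) ^ 2 * |F a - F b| := by
      have := mul_le_mul_of_nonneg_left h4 (by positivity : (0:ℝ) ≤ (B:ℝ) ^ 2)
      refine le_trans (le_of_eq ?_) this
      field_simp
    refine le_trans ?_ (Real.rpow_le_rpow (by positivity) h5 s.2)
    rw [Real.inv_rpow (by positivity), ← Real.rpow_natCast (B:ℝ) n, ← Real.rpow_mul hB.le, mul_comm,
      Real.rpow_mul hB.le, Real.rpow_natCast]
    gcongr
  have hFinj : Function.Injective F := by
    intro a b hab
    by_contra hne'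
    have hex : ∃ n, a n ≠ b n := Function.ne_iff.1 hne'
    classical
    have h1 := Nat.find_spec hex
    have h2 : ∀ i < Nat.find hex, a i = b i := fun i hi => not_not.1 (Nat.find_min hex hi)
    have h4 := sep (fun j => d j (a j)) (fun j => d j (b j)) (fun j => hd j _) (fun j => hd j _)
      (Nat.find hex)
      (fun i hi => by simp only [h2 i hi]) (fun h => h1 (hinj _ h))
    have h6 : Real.ofDigits (fun j => d j (a j)) = Real.ofDigits (fun j => d j (b j)) := hab
    rw [h6, sub_self, abs_zero] at h4
    have : (0:ℝ) < ((B:ℝ) ^ (Nat.find hex))⁻¹ * ((B:ℝ) ^ 2)⁻¹ := by positivity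
    linarith
  set f : ℝ → ℝ := fun x => Real.ofDigits (Function.invFun F x) with hf
  have hfF : ∀ a, f (F a) = Real.ofDigits a := fun a => by
    simp only [hf, Function.leftInverse_invFun hFinj a]
  have hhol : HolderOnWith (((B:NNReal) ^ 2) ^ (s:ℝ)) s f (range F) := by
    rintro _ ⟨a, rfl⟩ _ ⟨b, rfl⟩
    rw [hfF, hfF, edist_dist, edist_dist, Real.dist_eq, Real.dist_eq,
      ENNReal.ofReal_rpow_of_nonneg (abs_nonneg _) (NNReal.coe_nonneg s)]
    rw [← ENNReal.ofReal_coe_nnreal, ← ENNReal.ofReal_mul (by positivity)]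
    apply ENNReal.ofReal_le_ofReal
    simpa using key a b
  have h1 := hhol.dimH_image_le hs
  have h2 : dimH (f '' range F) = 1 := by
    have : f '' range F ∈ nhds (1/2 : ℝ) := by
      refine Filter.mem_of_superset (Icc_mem_nhds (a := 0) (b := 1) (by norm_num) (by norm_num)) ?_
      intro y hy
      obtain ⟨a, -, ha⟩ := Real.ofDigits_SurjOn (b := N) (by omega) hy
      exact ⟨F a, ⟨a, rfl⟩, by rw [hfF, ha]⟩
    rw [Real.dimH_of_mem_nhds this]
    simp
  rw [h2] at h1
  have hs' : (s : ENNReal) ≠ 0 := by exact_mod_cast hs.ne'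
  rw [ENNReal.le_div_iff_mul_le (Or.inl hs') (Or.inl ENNReal.coe_ne_top)] at h1
  simpa using h1

lemma level_pos {B : ℕ} (hB : 2 ≤ B) (hev : Even B) (a : ℕ → Fin B) (ha : ∀ j, Good B (a j)) :
    0 < dimH (levelSet (takagi (Real.ofDigits a))) := by
  have hB1 : (1:ℝ) < B := by exact_mod_cast hB
  have hlog : 0 < Real.log B := Real.log_pos hB1
  let s : NNReal := ⟨Real.log 2 / Real.log B, by positivity⟩
  have hs : 0 < s := by
    rw [← NNReal.coe_pos]
    exact div_pos (Real.log_pos one_lt_two) hlog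
  let d : ℕ → Fin 2 → Fin B := fun j e =>
    if e = 0 then a j else ⟨B - 1 - a j, by omega⟩
  have hd : ∀ j e, Good B (d j e) ∧ takagi ((d j e : ℕ) / B) = takagi ((a j : ℕ) / B) := by
    intro j e
    by_cases he : e = 0
    · simp [d, he, ha j]
    · simpa [d, he] using (ha j).flip
  have h := dim_lower (B := B) (le_refl 2) s hs ?_ d ?_ (fun j x => (hd j x).1.1)
  · refine lt_of_lt_of_le (by exact_mod_cast hs) (h.trans (dimH_mono ?_))
    rintro _ ⟨e, rfl⟩
    refine ⟨⟨Real.ofDigits_nonneg _, Real.ofDigits_le_one _⟩, ?_⟩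
    exact takagi_eq hB _ _ (fun j => (hd j _).1) ha (fun j => (hd j _).2)
  · change (B:ℝ) ^ (Real.log 2 / Real.log B) ≤ (2:ℕ)
    rw [Real.rpow_def_of_pos (by linarith), mul_div_cancel₀ _ hlog.ne', Real.exp_log two_pos]
    simp
  · intro j e e' hee
    obtain ⟨r, hr⟩ := hev
    have := (ha j).1
    have h0 : ((d j e : Fin B) : ℕ) = d j e' := by rw [hee]
    by_cases he : e = 0 <;> by_cases he' : e' = 0 <;> simp [d, he, he'] at h0 ⊢ <;> omega

lemma main_lower {k : ℕ} (hk : 1 ≤ k) (s : NNReal) (hs : 0 < s)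
    (h : ((2 ^ (2 * k) : ℕ) : ℝ) ^ (s:ℝ) ≤ Nat.centralBinom k) :
    (s : ENNReal) ≤ dimH {x ∈ Set.Icc (0 : ℝ) 1 | 0 < dimH (levelSet (takagi x))} := by
  set P := Finset.powersetCard k (Finset.range (2 * k)) with hP
  have hcard : P.card = Nat.centralBinom k := by
    rw [hP, Finset.card_powersetCard, Finset.card_range, Nat.centralBinom]
  have hgood : ∀ S ∈ P, Good (2 ^ (2 * k)) (∑ i ∈ S, 2 ^ i) := fun S hS => by
    rw [hP, Finset.mem_powersetCard] at hS
    exact good_of_card hk hS.1 hS.2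
  let e := P.equivFin.symm
  let d : ℕ → Fin P.card → Fin (2 ^ (2 * k)) := fun _ i =>
    ⟨∑ i ∈ (e i : Finset ℕ), 2 ^ i, by have := (hgood _ (e i).2).1; omega⟩
  have hN : 2 ≤ P.card := by
    rw [hcard]
    exact Nat.two_le_centralBinom k (by omega)
  refine (dim_lower hN s hs (by rw [hcard]; exact h) d ?_ ?_).trans (dimH_mono ?_)
  · intro j x y hxy
    have := congrArg Fin.val hxy
    exact e.injective (Subtype.ext (Finset.geomSum_injective (le_refl 2) this))
  · intro j x
    exact (hgood _ (e x).2).1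
  · rintro _ ⟨a, rfl⟩
    refine ⟨⟨Real.ofDigits_nonneg _, Real.ofDigits_le_one _⟩, ?_⟩
    refine level_pos ?_ ?_ _ (fun j => hgood _ (e (a j)).2)
    · exact Nat.le_self_pow (by omega) 2
    · exact Nat.even_pow.2 ⟨even_two, by omega⟩

lemma exists_k (s : ℝ) (hs : s < 1) :
    ∃ k : ℕ, 1 ≤ k ∧ ((2 ^ (2 * k) : ℕ) : ℝ) ^ s ≤ Nat.centralBinom k := by
  have hr : (1:ℝ) < (4:ℝ) ^ (1 - s) := Real.one_lt_rpow (by norm_num) (by linarith)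
  have hlim := tendsto_pow_const_div_const_pow_of_one_lt 1 hr
  have hev := hlim.eventually (gt_mem_nhds (by norm_num : (0:ℝ) < 1 / 2))
  obtain ⟨k, hk, hk1⟩ := (hev.and (Filter.eventually_ge_atTop 1)).exists
  refine ⟨k, hk1, ?_⟩
  rw [div_lt_iff₀ (by positivity), ← Real.rpow_natCast, ← Real.rpow_natCast,
    ← Real.rpow_mul (by norm_num)] at hk
  have h4 : (4:ℝ) ^ k ≤ 2 * k * Nat.centralBinom k := by
    exact_mod_cast Nat.four_pow_le_two_mul_self_mul_centralBinom k hk1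
  have h5 : ((2 ^ (2 * k) : ℕ) : ℝ) ^ s * (4:ℝ) ^ ((1 - s) * k) = 4 ^ k := by
    have : ((2 ^ (2 * k) : ℕ) : ℝ) = (4:ℝ) ^ (k:ℝ) := by
      push_cast
      rw [pow_mul, Real.rpow_natCast]
      norm_num
    rw [this, ← Real.rpow_mul (by norm_num), ← Real.rpow_add (by norm_num), ← Real.rpow_natCast]
    congr 1
    ring
  simp at hk
  set A := ((2 ^ (2 * k) : ℕ) : ℝ) ^ s
  have hA : 0 < A := by positivity
  have hkp : (0:ℝ) < k := by exact_mod_cast hk1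
  have : A * (2 * k) ≤ Nat.centralBinom k * (2 * k) := by
    calc A * (2 * k) ≤ A * (4:ℝ) ^ ((1 - s) * k) := by gcongr; linarith
      _ = 4 ^ k := h5
      _ ≤ _ := by linarith
  exact le_of_mul_le_mul_right this (by positivity)

end TakagiAux

/-- The set of abscissas whose Takagi level set has positive Hausdorff dimension has
full Hausdorff dimension. -/
theorem dimH_abscissas_positive_dim_levelSets :
    dimH {x ∈ Set.Icc (0 : ℝ) 1 | 0 < dimH (levelSet (takagi x))} = 1 := by
  apply le_antisymm
  · rw [← Real.dimH_univ]
    exact dimH_mono (subset_univ _)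
  · refine ENNReal.le_of_forall_nnreal_lt fun s hs => ?_
    rcases eq_or_ne s 0 with rfl | h0
    · simp
    have hs1 : (s:ℝ) < 1 := by exact_mod_cast hs
    obtain ⟨k, hk, h⟩ := TakagiAux.exists_k s hs1
    exact TakagiAux.main_lower hk s (pos_iff_ne_zero.2 h0) h
end
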